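/- Let q be a power of a prime and F_q the finite field with q elements. Let A ⊆ F_q with |A| ≥ 2, and suppose |A + A| ≤ K|A| for some constant K > 0 and that there is a constant C > 0 such that for every proper subfield G of F_q and all elements c, d ∈ F_q one has |A ∩ (cG + d)| ≤ C·max{|G|^{1/2}, |A|^{3/5}}. Then there are constants C', c' > 0 depending only on C and K such that: (i) T(A) ≤ C'·log|A|·(|A|^{5 - 1/5} + q^{-1/4}|A|^{5 + 1/4}); (ii) for every finite set L of lines in F_q^2, I(A × A, L) ≤ C'·((log|A|)^{1/3}·(|A|^{24/15} + q^{-1/12}|A|^{21/12})·|L|^{2/3} + |L|); and (iii) L(A × A) ≥ c'·(log|A|)^{-2}·min{|A|^{2 + 2/5}, q^{1/2}|A|^{2 - 1/2}}. -/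

import Mathlib

open scoped Classical Pointwise

noncomputable section

namespace STP

variable {F : Type} [Field F]

def collinearTriples (A B : Finset F) : ℕ :=
  (((A ×ˢ A ×ˢ A) ×ˢ (B ×ˢ B ×ˢ B)).filter fun x =>
    (x.1.2.1 - x.1.1) * (x.2.2.2 - x.2.1) = (x.1.2.2 - x.1.1) * (x.2.2.1 - x.2.1)).card

def IsLine (l : Set (F × F)) : Prop :=
  ∃ a b c : F, (a, b) ≠ (0, 0) ∧ l = {p : F × F | a * p.1 + b * p.2 = c}

def incidences (P : Finset (F × F)) (L : Finset (Set (F × F))) : ℕ :=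
  ((P ×ˢ L).filter fun x => x.1 ∈ x.2).card

def kIncidences (P : Finset (F × F)) (L : Finset (Set (F × F))) (k : ℕ) : ℕ :=
  (((Fintype.piFinset fun _ : Fin k => P) ×ˢ L).filter fun x => ∀ i, x.1 i ∈ x.2).card

def numLines (P : Finset (F × F)) : ℕ :=
  Set.ncard {l : Set (F × F) | IsLine l ∧ 2 ≤ (P.filter (· ∈ l)).card}

def addEnergy (X Y : Finset F) : ℕ :=
  (((X ×ˢ X) ×ˢ (Y ×ˢ Y)).filter fun t => t.1.1 + t.2.1 = t.1.2 + t.2.2).card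

def mulEnergy (A : Finset F) : ℕ :=
  (((A ×ˢ A) ×ˢ (A ×ˢ A)).filter fun t => t.1.1 * t.2.1 = t.1.2 * t.2.2).card

def quotSet (X : Finset F) : Set F :=
  {r : F | ∃ x1 ∈ X, ∃ x2 ∈ X, ∃ x3 ∈ X, ∃ x4 ∈ X, x3 ≠ x4 ∧ r = (x1 - x2) / (x3 - x4)}

def subfieldCond (A : Finset F) (C bound : ℝ) : Prop :=
  ∀ G : Subfield F, G ≠ ⊤ → ∀ c d : F,
    ((A.filter fun x => ∃ g ∈ G, x = c * g + d).card : ℝ) ≤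
      C * max ((Nat.card G : ℝ) ^ ((1:ℝ)/2)) bound

def linesOf [Fintype F] (P : Finset (F × F)) : Finset (Set (F × F)) :=
  Set.Finite.toFinset (Set.toFinite {l : Set (F × F) | IsLine l ∧ 2 ≤ (P.filter (· ∈ l)).card})

def tripleCount [Fintype F] (P : Finset (F × F)) : ℕ :=
  ∑ l ∈ linesOf P, ((P.filter (· ∈ l)).card) ^ 3

lemma cs_image {α β : Type} (s : Finset α) (f : α → β) :
    s.card ^ 2 ≤ (s.image f).card * ((s ×ˢ s).filter fun p => f p.1 = f p.2).card := by
  have h1 : s.card = ∑ b ∈ s.image f, (s.filter fun a => f a = b).card :=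
    Finset.card_eq_sum_card_fiberwise (fun x hx => by
      simpa using ⟨x, hx, rfl⟩)
  have h2 : ((s ×ˢ s).filter fun p => f p.1 = f p.2).card =
      ∑ b ∈ s.image f, (s.filter fun a => f a = b).card ^ 2 := by
    rw [Finset.card_eq_sum_card_fiberwise (f := fun p : α × α => f p.1) (t := s.image f)]
    · refine Finset.sum_congr rfl fun b hb => ?_
      rw [sq, ← Finset.card_product]
      congr 1
      ext p
      simp only [Finset.mem_filter, Finset.mem_product]
      constructor
      · rintro ⟨⟨⟨h1, h2⟩, h3⟩, h4⟩
        exact ⟨⟨h1, h4⟩, h2, h3 ▸ h4⟩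
      · rintro ⟨⟨h1, h4⟩, h2, h3⟩
        exact ⟨⟨⟨h1, h2⟩, h4.trans h3.symm⟩, h4⟩
    · intro x hx
      simp only [Finset.coe_filter, Finset.mem_product, Set.mem_ofPred_eq] at hx
      simpa using ⟨x.1, hx.1.1, rfl⟩
  rw [h2]
  conv_lhs => rw [h1]
  exact sq_sum_le_card_mul_sum_sq

def dil (W : Finset F) (ξ : F) : Finset F := (W ×ˢ W).image fun p => p.1 + ξ * p.2

lemma dil_card_of_notMem (W : Finset F) (ξ : F) (h : ξ ∉ quotSet W) :
    (dil W ξ).card = W.card ^ 2 := by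
  unfold dil
  rw [Finset.card_image_of_injOn, Finset.card_product, sq]
  rintro ⟨a, b⟩ hab ⟨c, d⟩ hcd heq
  simp only [Finset.coe_product, Set.mem_prod, Finset.mem_coe] at hab hcd heq
  by_cases hbd : b = d
  · subst hbd
    simp at heq
    simp [heq]
  · exfalso
    apply h
    refine ⟨c, hcd.1, a, hab.1, b, hab.2, d, hcd.2, hbd, ?_⟩
    rw [eq_div_iff (sub_ne_zero.2 hbd)]
    linear_combination heq

lemma exists_field [Fintype F] (W : Finset F) (h0 : ∀ w ∈ W, w ≠ 0) (h2 : 2 ≤ W.card)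
    (hadd : ∀ r ∈ quotSet W, 1 + r ∈ quotSet W)
    (hmul : ∀ w ∈ W, ∀ r ∈ quotSet W, w * r ∈ quotSet W) :
    ∃ G : Subfield F, (∀ w ∈ W, w ∈ G) ∧ ∀ g ∈ G, g ∈ quotSet W := by
  have hneg : ∀ r ∈ quotSet W, -r ∈ quotSet W := by
    rintro r ⟨a, ha, b, hb, c, hc, d, hd, hcd, rfl⟩
    exact ⟨b, hb, a, ha, c, hc, d, hd, hcd, by rw [← neg_div, neg_sub]⟩
  have hzero : (0 : F) ∈ quotSet W := by
    obtain ⟨a, ha, b, hb, hab⟩ := Finset.one_lt_card.1 h2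
    exact ⟨a, ha, a, ha, a, ha, b, hb, hab, by simp⟩
  have hM : ∀ x ∈ Submonoid.closure (W : Set F), x ≠ 0 ∧ ∀ r ∈ quotSet W, x * r ∈ quotSet W := by
    intro x hx
    induction hx using Submonoid.closure_induction with
    | mem x hx => exact ⟨h0 x hx, hmul x hx⟩
    | one => exact ⟨one_ne_zero, fun r hr => by simpa using hr⟩
    | mul x y _ _ hx hy =>
      exact ⟨mul_ne_zero hx.1 hy.1, fun r hr => by rw [mul_assoc]; exact hx.2 _ (hy.2 r hr)⟩
  have hpow : ∀ x : F, x ≠ 0 → x⁻¹ = x ^ (Fintype.card F - 2) := by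
    intro x hx
    have h1 := FiniteField.pow_card_sub_one_eq_one x hx
    have h3 : 1 < Fintype.card F := Fintype.one_lt_card
    apply inv_eq_of_mul_eq_one_left
    rw [← pow_succ, ← h1]; congr 1; omega
  have hA : ∀ x ∈ Submonoid.closure (W : Set F), ∀ r ∈ quotSet W, x + r ∈ quotSet W := by
    intro x hx r hr
    obtain ⟨hx0, hxm⟩ := hM x hx
    have h3 : x⁻¹ * r ∈ quotSet W := by
      rw [hpow x hx0]
      exact (hM _ (pow_mem hx _)).2 r hr
    have h4 := hxm _ (hadd _ h3)
    rwa [mul_add, mul_one, mul_inv_cancel_left₀ hx0] at h4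
  have hR : ∀ x ∈ Subring.closure (W : Set F), ∀ r ∈ quotSet W, x + r ∈ quotSet W := by
    intro x hx
    rw [Subring.mem_closure_iff] at hx
    induction hx using AddSubgroup.closure_induction with
    | mem x hx => exact hA x hx
    | zero => intro r hr; simpa using hr
    | add x y _ _ hx hy => intro r hr; rw [add_assoc]; exact hx _ (hy r hr)
    | neg x _ hx =>
      intro r hr
      have := hneg _ (hx _ (hneg r hr))
      rwa [neg_add, neg_neg] at this
  refine ⟨{ Subring.closure (W : Set F) with
    inv_mem' := ?_ }, ?_, ?_⟩
  · intro x hx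
    by_cases hx0 : x = 0
    · subst hx0; simp
    · rw [hpow x hx0]
      have hx' : x ∈ Subring.closure (W : Set F) := hx
      exact pow_mem hx' _
  · intro w hw
    exact Subring.subset_closure hw
  · intro g hg
    have := hR g hg 0 hzero
    simpa using this

lemma exists_dil [Fintype F] (W : Finset F) (G : Subfield F) :
    ∃ ξ ∈ G, W.card ^ 4 * Nat.card G ≤
      (dil W ξ).card * (W.card ^ 2 * Nat.card G + W.card ^ 4) := by
  set Gf : Finset F := Finset.univ.filter (· ∈ G) with hGf
  have hG : Nat.card G = Gf.card := by
    rw [Nat.card_eq_fintype_card, hGf]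
    exact Fintype.card_subtype _
  set E : F → ℕ := fun ξ => (((W ×ˢ W) ×ˢ (W ×ˢ W)).filter fun p : (F × F) × (F × F) =>
    p.1.1 + ξ * p.1.2 = p.2.1 + ξ * p.2.2).card with hE
  have hcs : ∀ ξ, W.card ^ 4 ≤ (dil W ξ).card * E ξ := by
    intro ξ
    have := cs_image (W ×ˢ W) (fun p : F × F => p.1 + ξ * p.2)
    rw [Finset.card_product] at this
    calc W.card ^ 4 = (W.card * W.card) ^ 2 := by ring
      _ ≤ _ := this
  have hsum : ∑ ξ ∈ Gf, E ξ ≤ W.card ^ 2 * Gf.card + W.card ^ 4 := by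
    have e1 : ∑ ξ ∈ Gf, E ξ = ∑ p ∈ ((W ×ˢ W) ×ˢ (W ×ˢ W)),
        (Gf.filter fun ξ => p.1.1 + ξ * p.1.2 = p.2.1 + ξ * p.2.2).card := by
      simp only [hE, Finset.card_filter]
      rw [Finset.sum_comm]
    have e2 : ∀ p ∈ ((W ×ˢ W) ×ˢ (W ×ˢ W)),
        (Gf.filter fun ξ => p.1.1 + ξ * p.1.2 = p.2.1 + ξ * p.2.2).card ≤
        (if p.1 = p.2 then Gf.card else 0) + 1 := by
      rintro ⟨⟨a, b⟩, c, d⟩ _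
      split_ifs with h
      · exact (Finset.card_filter_le _ _).trans (by omega)
      · rw [zero_add, Finset.card_le_one]
        intro x hx y hy
        simp only [Finset.mem_filter] at hx hy
        by_cases hbd : b = d
        · exfalso; apply h
          have := hx.2
          subst hbd
          simp at this
          simp [this]
        · apply mul_right_cancel₀ (sub_ne_zero.2 hbd)
          linear_combination hx.2 - hy.2
    rw [e1]
    refine (Finset.sum_le_sum e2).trans ?_
    rw [Finset.sum_add_distrib]
    apply le_of_eq
    congr 1
    · rw [Finset.sum_product]
      have : ∀ x ∈ W ×ˢ W, (∑ y ∈ W ×ˢ W, if x = y then Gf.card else 0) = Gf.card := by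
        intro x hx
        rw [Finset.sum_ite_eq, if_pos hx]
      rw [Finset.sum_congr rfl this, Finset.sum_const, Finset.card_product, smul_eq_mul, sq]
    · simp; ring
  have hne : Gf.Nonempty := ⟨0, by simp [hGf, G.zero_mem]⟩
  obtain ⟨ξ, hξ, hle⟩ := Finset.exists_le_of_sum_le (s := Gf) (f := fun ξ => Gf.card * E ξ)
    (g := fun _ => W.card ^ 2 * Gf.card + W.card ^ 4) hne (by
      rw [← Finset.mul_sum]
      simpa using Nat.mul_le_mul_left _ hsum)
  refine ⟨ξ, by simpa [hGf] using hξ, ?_⟩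
  rw [hG]
  calc W.card ^ 4 * Gf.card ≤ (dil W ξ).card * E ξ * Gf.card := Nat.mul_le_mul_right _ (hcs ξ)
    _ = (dil W ξ).card * (Gf.card * E ξ) := by ring
    _ ≤ _ := Nat.mul_le_mul_left _ hle

lemma plu (A : Finset F) (hA : A.Nonempty) (K : ℝ)
    (hK : ((A + A).card : ℝ) ≤ K * A.card) (m n : ℕ) :
    ((m • A - n • A).card : ℝ) ≤ K ^ (m + n) * A.card := by
  have h := Finset.pluennecke_ruzsa_inequality_nsmul_sub_nsmul_add hA A m n
  have h' : ((m • A - n • A).card : ℝ) ≤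
      (((A + A).card : ℝ) / A.card) ^ (m + n) * A.card := by
    have := (NNRat.cast_le (K := ℝ)).2 h
    push_cast at this
    exact this
  refine h'.trans ?_
  have ha : (0 : ℝ) < A.card := by exact_mod_cast hA.card_pos
  gcongr
  rwa [div_le_iff₀ ha]

def ncount (A : Finset F) (l : F) : ℕ :=
  ((A ×ˢ A ×ˢ A).filter fun p => p.2.2 ≠ p.1 ∧ p.2.1 - p.1 = l * (p.2.2 - p.1)).card

lemma ncount_le (A : Finset F) (l : F) :
    ncount A l ≤ ((A ×ˢ A).filter fun p => p.1 ≠ p.2 ∧ p.1 + l * (p.2 - p.1) ∈ A).card := by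
  unfold ncount
  refine Finset.card_le_card_of_injOn (fun p => (p.1, p.2.2)) ?_ ?_
  · rintro ⟨a, b, c⟩ h
    simp only [Finset.coe_filter, Finset.mem_product, Set.mem_ofPred_eq] at h ⊢
    refine ⟨⟨h.1.1, h.1.2.2⟩, h.2.1.symm, ?_⟩
    rw [← h.2.2]
    simpa using h.1.2.1
  · rintro ⟨a, b, c⟩ h ⟨a', b', c'⟩ h' heq
    simp only [Finset.coe_filter, Finset.mem_product, Set.mem_ofPred_eq] at h h' heq
    simp only [Prod.mk.injEq] at heq ⊢
    obtain ⟨rfl, rfl⟩ := heq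
    refine ⟨rfl, ?_, rfl⟩
    linear_combination h.2.2 - h'.2.2

lemma cover (A : Finset F) (hA : A.Nonempty) (K : ℝ)
    (hK : ((A + A).card : ℝ) ≤ K * A.card) (l : F) (n : ℕ) (hn : 1 ≤ n) (hl : n ≤ ncount A l) :
    ∃ S : Finset F, (S.card : ℝ) * n ≤ K ^ 5 * (A.card : ℝ) ^ 2 ∧
      ∀ d ∈ 2 • A - 2 • A, ∃ s ∈ S, ∃ z ∈ A - A, l * d = s + z := by
  have h1 : n ≤ ∑ a ∈ A, (A.filter fun x => a + l * (x - a) ∈ A).card := by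
    refine hl.trans ((ncount_le A l).trans ?_)
    calc _ ≤ ((A ×ˢ A).filter fun p => p.1 + l * (p.2 - p.1) ∈ A).card := by
            apply Finset.card_le_card
            intro p hp
            simp only [Finset.mem_filter] at hp ⊢
            exact ⟨hp.1, hp.2.2⟩
      _ = _ := by
        simp only [Finset.card_filter]
        rw [Finset.sum_product]
  obtain ⟨a, ha, hle⟩ := Finset.exists_le_of_sum_le (s := A) (f := fun _ => n)
    (g := fun a => A.card * (A.filter fun x => a + l * (x - a) ∈ A).card) hA (by
      rw [← Finset.mul_sum]
      simpa using Nat.mul_le_mul_left _ h1)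
  set X := A.filter fun x => a + l * (x - a) ∈ A with hX
  have hXne : X.Nonempty := by
    rw [Finset.nonempty_iff_ne_empty]
    intro h
    rw [h] at hle
    simp at hle
    omega
  have hXpos : (0 : ℝ) < X.card := by exact_mod_cast hXne.card_pos
  have hsub : (2 • A - 2 • A) + X ⊆ 3 • A - 2 • A := by
    refine (Finset.add_subset_add_left (Finset.filter_subset _ A)).trans ?_
    rw [succ_nsmul A 2, add_comm (2 • A) A, add_comm, add_sub_assoc]
  have hb : (((2 • A - 2 • A) + X).card : ℝ) ≤ (K ^ 5 * A.card / X.card) * X.card := by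
    rw [div_mul_cancel₀ _ hXpos.ne']
    refine le_trans ?_ (plu A hA K hK 3 2)
    exact_mod_cast Finset.card_le_card hsub
  obtain ⟨S, -, hS, hcov⟩ := Finset.ruzsa_covering_add hXne hb
  refine ⟨S.image (l * ·), ?_, ?_⟩
  · have h3 : ((S.image (l * ·)).card : ℝ) ≤ S.card := by exact_mod_cast Finset.card_image_le
    have h4 : (n : ℝ) ≤ A.card * X.card := by exact_mod_cast hle
    rw [le_div_iff₀ hXpos] at hS
    calc ((S.image (l * ·)).card : ℝ) * n ≤ S.card * (A.card * X.card) := by gcongr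
      _ = (S.card * X.card) * A.card := by ring
      _ ≤ (K ^ 5 * A.card) * A.card := by gcongr
      _ = _ := by ring
  · intro d hd
    obtain ⟨s, hs, y, hy, rfl⟩ := Finset.mem_add.1 (hcov hd)
    obtain ⟨u, hu, v, hv, rfl⟩ := Finset.mem_sub.1 hy
    refine ⟨l * s, Finset.mem_image_of_mem _ hs, (a + l * (u - a)) - (a + l * (v - a)), ?_, by ring⟩
    exact Finset.sub_mem_sub (Finset.mem_filter.1 hu).2 (Finset.mem_filter.1 hv).2

set_option maxHeartbeats 1000000 in
/-- Abstract data used in the pivot argument. -/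
lemma dil_bounds (A W : Finset F) (c τ : ℝ) (e : F) (he : e ≠ 0) (hA : A.Nonempty)
    (hτ : 1 ≤ τ) (hc : ((4 • A - 4 • A).card : ℝ) ≤ c)
    (hW : ∀ w ∈ W, e * w ∈ A - A)
    (hcov : ∀ w ∈ W, ∃ S : Finset F, (S.card : ℝ) ≤ τ ∧
      ∀ d ∈ 2 • A - 2 • A, ∃ s ∈ S, ∃ z ∈ A - A, w * d = s + z) :
    (∀ r ∈ quotSet W, ((dil W r).card : ℝ) ≤ τ ^ 4 * c) ∧
    (∀ r ∈ quotSet W, ((dil W (1 + r)).card : ℝ) ≤ τ ^ 4 * c) ∧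
    (∀ w ∈ W, ∀ r ∈ quotSet W, ((dil W (w * r)).card : ℝ) ≤ τ ^ 5 * c) := by
  have hD1 : ∀ z ∈ A - A, z ∈ 2 • A - 2 • A := by
    intro z hz
    obtain ⟨u, hu, v, hv, rfl⟩ := Finset.mem_sub.1 hz
    obtain ⟨a, ha⟩ := hA
    have : u - v = (u + a) - (v + a) := by ring
    rw [this, two_nsmul]
    exact Finset.sub_mem_sub (Finset.add_mem_add hu ha) (Finset.add_mem_add hv ha)
  have hD2 : ∀ z ∈ A - A, ∀ z' ∈ A - A, z + z' ∈ 2 • A - 2 • A := by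
    intro z hz z' hz'
    obtain ⟨u, hu, v, hv, rfl⟩ := Finset.mem_sub.1 hz
    obtain ⟨u', hu', v', hv', rfl⟩ := Finset.mem_sub.1 hz'
    have : u - v + (u' - v') = (u + u') - (v + v') := by ring
    rw [this, two_nsmul]
    exact Finset.sub_mem_sub (Finset.add_mem_add hu hu') (Finset.add_mem_add hv hv')
  have hZn : ∀ z ∈ A - A, -z ∈ A - A := by
    intro z hz
    obtain ⟨u, hu, v, hv, rfl⟩ := Finset.mem_sub.1 hz
    rw [neg_sub]
    exact Finset.sub_mem_sub hv hu
  have hZ0 : (0 : F) ∈ A - A := by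
    obtain ⟨a, ha⟩ := hA
    have := Finset.sub_mem_sub ha ha
    rwa [sub_self] at this
  have h4 : ∀ z1 ∈ A - A, ∀ z2 ∈ A - A, ∀ z3 ∈ A - A, ∀ z4 ∈ A - A,
      z1 + z2 + z3 + z4 ∈ 4 • A - 4 • A := by
    intro z1 h1 z2 h2 z3 h3 z4 h4
    obtain ⟨u1, hu1, v1, hv1, rfl⟩ := Finset.mem_sub.1 h1
    obtain ⟨u2, hu2, v2, hv2, rfl⟩ := Finset.mem_sub.1 h2
    obtain ⟨u3, hu3, v3, hv3, rfl⟩ := Finset.mem_sub.1 h3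
    obtain ⟨u4, hu4, v4, hv4, rfl⟩ := Finset.mem_sub.1 h4
    have : u1 - v1 + (u2 - v2) + (u3 - v3) + (u4 - v4) =
      (u1 + u2 + u3 + u4) - (v1 + v2 + v3 + v4) := by ring
    rw [this]
    have e4 : 4 • A = A + A + A + A := by
      rw [succ_nsmul, succ_nsmul, two_nsmul]
    rw [e4]
    exact Finset.sub_mem_sub
      (Finset.add_mem_add (Finset.add_mem_add (Finset.add_mem_add hu1 hu2) hu3) hu4)
      (Finset.add_mem_add (Finset.add_mem_add (Finset.add_mem_add hv1 hv2) hv3) hv4)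
  generalize 4 • A - 4 • A = P at *
  generalize 2 • A - 2 • A = D at *
  generalize A - A = Z at *
  have hc0 : 0 ≤ c := le_trans (Nat.cast_nonneg _) hc
  have hfin4 : ∀ (S1 S2 S3 S4 T : Finset F), (S1.card : ℝ) ≤ τ → (S2.card : ℝ) ≤ τ →
      (S3.card : ℝ) ≤ τ → (S4.card : ℝ) ≤ τ → T ⊆ S1 + S2 + S3 + S4 + P →
      (T.card : ℝ) ≤ τ ^ 4 * c := by
    intro S1 S2 S3 S4 T h1 h2 h3 h4 hT
    have : T.card ≤ S1.card * S2.card * S3.card * S4.card * P.card :=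
      (Finset.card_le_card hT).trans (Finset.card_add_le.trans (Nat.mul_le_mul_right _
        (Finset.card_add_le.trans (Nat.mul_le_mul_right _ (Finset.card_add_le.trans
          (Nat.mul_le_mul_right _ Finset.card_add_le))))))
    calc (T.card : ℝ) ≤ S1.card * S2.card * S3.card * S4.card * P.card := by exact_mod_cast this
      _ ≤ τ * τ * τ * τ * c := by gcongr
      _ = _ := by ring
  have hfin5 : ∀ (S1 S2 S3 S4 S5 T : Finset F), (S1.card : ℝ) ≤ τ → (S2.card : ℝ) ≤ τ →
      (S3.card : ℝ) ≤ τ → (S4.card : ℝ) ≤ τ → (S5.card : ℝ) ≤ τ →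
      T ⊆ S1 + S2 + S3 + S4 + S5 + P →
      (T.card : ℝ) ≤ τ ^ 5 * c := by
    intro S1 S2 S3 S4 S5 T h1 h2 h3 h4 h5 hT
    have : T.card ≤ S1.card * S2.card * S3.card * S4.card * S5.card * P.card :=
      (Finset.card_le_card hT).trans (Finset.card_add_le.trans (Nat.mul_le_mul_right _
        (Finset.card_add_le.trans (Nat.mul_le_mul_right _ (Finset.card_add_le.trans
          (Nat.mul_le_mul_right _ (Finset.card_add_le.trans
          (Nat.mul_le_mul_right _ Finset.card_add_le))))))))
    calc (T.card : ℝ) ≤ S1.card * S2.card * S3.card * S4.card * S5.card * P.card := by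
          exact_mod_cast this
      _ ≤ τ * τ * τ * τ * τ * c := by gcongr
      _ = _ := by ring
  have hscale : ∀ (ξ k : F), k ≠ 0 → (dil W ξ).card = ((dil W ξ).image (fun x => k * x)).card := by
    intro ξ k hk
    rw [Finset.card_image_of_injective]
    exact mul_right_injective₀ hk
  choose! S hS hSc using hcov
  have hneg : ∀ w ∈ W, ((-S w).card : ℝ) ≤ τ := by
    intro w hw; rw [Finset.card_neg]; exact hS w hw
  refine ⟨?_, ?_, ?_⟩
  · rintro r ⟨w1, h1, w2, h2, w3, h3, w4, h4', hne, rfl⟩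
    have hne' := sub_ne_zero.2 hne
    rw [hscale _ ((w3 - w4) * e) (mul_ne_zero hne' he)]
    refine hfin4 (S w3) (-S w4) (S w1) (-S w2) _ (hS _ h3) (hneg _ h4') (hS _ h1) (hneg _ h2) ?_
    intro x hx
    simp only [dil, Finset.mem_image, Finset.mem_product, Prod.exists] at hx
    obtain ⟨_, ⟨u, v, ⟨hu, hv⟩, rfl⟩, rfl⟩ := hx
    obtain ⟨s3, hs3, z3, hz3, q3⟩ := hSc w3 h3 _ (hD1 _ (hW u hu))
    obtain ⟨s4, hs4, z4, hz4, q4⟩ := hSc w4 h4' _ (hD1 _ (hW u hu))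
    obtain ⟨s1, hs1, z1, hz1, q1⟩ := hSc w1 h1 _ (hD1 _ (hW v hv))
    obtain ⟨s2, hs2, z2, hz2, q2⟩ := hSc w2 h2 _ (hD1 _ (hW v hv))
    have : (w3 - w4) * e * (u + (w1 - w2) / (w3 - w4) * v) =
        s3 + -s4 + s1 + -s2 + (z3 + -z4 + z1 + -z2) := by
      have : (w3 - w4) * e * (u + (w1 - w2) / (w3 - w4) * v) =
        w3 * (e * u) - w4 * (e * u) + w1 * (e * v) - w2 * (e * v) := by
        field_simp
        ring
      rw [this, q1, q2, q3, q4]; ring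
    rw [this]
    exact Finset.add_mem_add (Finset.add_mem_add (Finset.add_mem_add (Finset.add_mem_add hs3
      (Finset.neg_mem_neg hs4)) hs1) (Finset.neg_mem_neg hs2))
      (h4 _ hz3 _ (hZn _ hz4) _ hz1 _ (hZn _ hz2))
  · rintro r ⟨w1, h1, w2, h2, w3, h3, w4, h4', hne, rfl⟩
    have hne' := sub_ne_zero.2 hne
    rw [hscale _ ((w3 - w4) * e) (mul_ne_zero hne' he)]
    refine hfin4 (S w3) (-S w4) (S w1) (-S w2) _ (hS _ h3) (hneg _ h4') (hS _ h1) (hneg _ h2) ?_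
    intro x hx
    simp only [dil, Finset.mem_image, Finset.mem_product, Prod.exists] at hx
    obtain ⟨_, ⟨u, v, ⟨hu, hv⟩, rfl⟩, rfl⟩ := hx
    obtain ⟨s3, hs3, z3, hz3, q3⟩ := hSc w3 h3 _ (hD2 _ (hW u hu) _ (hW v hv))
    obtain ⟨s4, hs4, z4, hz4, q4⟩ := hSc w4 h4' _ (hD2 _ (hW u hu) _ (hW v hv))
    obtain ⟨s1, hs1, z1, hz1, q1⟩ := hSc w1 h1 _ (hD1 _ (hW v hv))
    obtain ⟨s2, hs2, z2, hz2, q2⟩ := hSc w2 h2 _ (hD1 _ (hW v hv))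
    have : (w3 - w4) * e * (u + (1 + (w1 - w2) / (w3 - w4)) * v) =
        s3 + -s4 + s1 + -s2 + (z3 + -z4 + z1 + -z2) := by
      have : (w3 - w4) * e * (u + (1 + (w1 - w2) / (w3 - w4)) * v) =
        w3 * (e * u + e * v) - w4 * (e * u + e * v) + w1 * (e * v) - w2 * (e * v) := by
        field_simp
        ring
      rw [this, q1, q2, q3, q4]; ring
    rw [this]
    exact Finset.add_mem_add (Finset.add_mem_add (Finset.add_mem_add (Finset.add_mem_add hs3
      (Finset.neg_mem_neg hs4)) hs1) (Finset.neg_mem_neg hs2))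
      (h4 _ hz3 _ (hZn _ hz4) _ hz1 _ (hZn _ hz2))
  · rintro w hw r ⟨w1, h1, w2, h2, w3, h3, w4, h4', hne, rfl⟩
    have hne' := sub_ne_zero.2 hne
    rw [hscale _ ((w3 - w4) * e) (mul_ne_zero hne' he)]
    have him : ∀ v ∈ W, (((S v).image (w * ·)).card : ℝ) ≤ τ := fun v hv =>
      le_trans (by exact_mod_cast Finset.card_image_le) (hS v hv)
    refine hfin5 (S w3) (-S w4) ((S w1).image (w * ·)) (-((S w2).image (w * ·))) (S w) _
      (hS _ h3) (hneg _ h4') (him _ h1) (by rw [Finset.card_neg]; exact him _ h2) (hS _ hw) ?_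
    intro x hx
    simp only [dil, Finset.mem_image, Finset.mem_product, Prod.exists] at hx
    obtain ⟨_, ⟨u, v, ⟨hu, hv⟩, rfl⟩, rfl⟩ := hx
    obtain ⟨s3, hs3, z3, hz3, q3⟩ := hSc w3 h3 _ (hD1 _ (hW u hu))
    obtain ⟨s4, hs4, z4, hz4, q4⟩ := hSc w4 h4' _ (hD1 _ (hW u hu))
    obtain ⟨s1, hs1, z1, hz1, q1⟩ := hSc w1 h1 _ (hD1 _ (hW v hv))
    obtain ⟨s2, hs2, z2, hz2, q2⟩ := hSc w2 h2 _ (hD1 _ (hW v hv))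
    obtain ⟨s5, hs5, z5, hz5, q5⟩ := hSc w hw _ (hD2 _ hz1 _ (hZn _ hz2))
    have : (w3 - w4) * e * (u + (w * ((w1 - w2) / (w3 - w4))) * v) =
        s3 + -s4 + w * s1 + -(w * s2) + s5 + (z3 + -z4 + z5 + 0) := by
      have : (w3 - w4) * e * (u + (w * ((w1 - w2) / (w3 - w4))) * v) =
        w3 * (e * u) - w4 * (e * u) + w * (w1 * (e * v) - w2 * (e * v)) := by
        field_simp
      rw [this, q1, q2, q3, q4]
      linear_combination q5
    rw [this]
    exact Finset.add_mem_add (Finset.add_mem_add (Finset.add_mem_add (Finset.add_mem_add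
      (Finset.add_mem_add hs3 (Finset.neg_mem_neg hs4)) (Finset.mem_image_of_mem _ hs1))
      (Finset.neg_mem_neg (Finset.mem_image_of_mem _ hs2))) hs5)
      (h4 _ hz3 _ (hZn _ hz4) _ hz5 _ hZ0)

def Lam [Fintype F] (A : Finset F) (n : ℕ) : Finset F :=
  Finset.univ.filter fun l => l ≠ 0 ∧ n ≤ ncount A l

lemma sum_ncount_le [Fintype F] (A : Finset F) : ∑ l : F, ncount A l ≤ A.card ^ 3 := by
  unfold ncount
  simp only [Finset.card_filter]
  rw [Finset.sum_comm]
  have : ∀ p ∈ A ×ˢ A ×ˢ A, (∑ l : F, if p.2.2 ≠ p.1 ∧ p.2.1 - p.1 = l * (p.2.2 - p.1)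
      then 1 else 0) ≤ 1 := by
    intro p _
    rw [← Finset.card_filter, Finset.card_le_one]
    intro x hx y hy
    simp only [Finset.mem_filter] at hx hy
    apply mul_right_cancel₀ (sub_ne_zero.2 hx.2.1)
    rw [← hx.2.2, ← hy.2.2]
  refine (Finset.sum_le_sum this).trans ?_
  simp
  apply le_of_eq
  ring

lemma Lam_mul_le [Fintype F] (A : Finset F) (n : ℕ) : (Lam A n).card * n ≤ A.card ^ 3 := by
  calc (Lam A n).card * n = ∑ l ∈ Lam A n, n := by simp
    _ ≤ ∑ l ∈ Lam A n, ncount A l := Finset.sum_le_sum fun l hl => by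
        simp only [Lam, Finset.mem_filter] at hl; exact hl.2.2
    _ ≤ ∑ l : F, ncount A l := Finset.sum_le_univ_sum_of_nonneg (fun _ => Nat.zero_le _)
    _ ≤ _ := sum_ncount_le A

lemma ncount_le_sq (A : Finset F) (l : F) : ncount A l ≤ A.card ^ 2 := by
  refine (ncount_le A l).trans ((Finset.card_filter_le _ _).trans ?_)
  rw [Finset.card_product, sq]

lemma exists_W [Fintype F] (A : Finset F) (hA : A.Nonempty) (n : ℕ) (hn : 1 ≤ n)
    (hL : (Lam A n).Nonempty) :
    ∃ a1 ∈ A, ∃ a3 ∈ A, a1 ≠ a3 ∧ (Lam A n).card * n ≤ A.card ^ 2 *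
      ((Lam A n).filter fun l => a1 + l * (a3 - a1) ∈ A).card := by
  have h1 : (Lam A n).card * n ≤ ∑ p ∈ A ×ˢ A,
      ((Lam A n).filter fun l => p.1 ≠ p.2 ∧ p.1 + l * (p.2 - p.1) ∈ A).card := by
    calc (Lam A n).card * n = ∑ l ∈ Lam A n, n := by simp
      _ ≤ ∑ l ∈ Lam A n, ((A ×ˢ A).filter fun p => p.1 ≠ p.2 ∧ p.1 + l * (p.2 - p.1) ∈ A).card :=
        Finset.sum_le_sum fun l hl => by
          simp only [Lam, Finset.mem_filter] at hl
          exact hl.2.2.trans (ncount_le A l)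
      _ = _ := by
        simp only [Finset.card_filter]
        rw [Finset.sum_comm]
  obtain ⟨⟨a1, a3⟩, hp, hle⟩ := Finset.exists_le_of_sum_le (s := A ×ˢ A)
    (f := fun _ => (Lam A n).card * n)
    (g := fun p : F × F => A.card ^ 2 *
      ((Lam A n).filter fun l => p.1 ≠ p.2 ∧ p.1 + l * (p.2 - p.1) ∈ A).card)
    (hA.product hA) (by
      rw [Finset.sum_const, Finset.card_product, smul_eq_mul, ← sq]
      rw [← Finset.mul_sum]
      exact Nat.mul_le_mul_left _ h1)
  rw [Finset.mem_product] at hp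
  by_cases h : a1 = a3
  · exfalso
    simp only [h, ne_eq, not_true_eq_false, false_and, Finset.filter_false, Finset.card_empty,
      mul_zero, Nat.le_zero, mul_eq_zero] at hle
    have := hL.card_pos
    omega
  · refine ⟨a1, hp.1, a3, hp.2, h, ?_⟩
    simpa only [ne_eq, h, not_false_eq_true, true_and] using hle

set_option maxHeartbeats 2000000 in
lemma trichotomy [Fintype F] (C K : ℝ) (hC : 0 < C) (hK1 : 1 ≤ K) (A : Finset F)
    (hA : A.Nonempty) (hK : ((A + A).card : ℝ) ≤ K * A.card)
    (hsub : subfieldCond A C ((A.card : ℝ) ^ ((3:ℝ)/5))) (n : ℕ) (hn : 1 ≤ n)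
    (hna : n ≤ A.card ^ 2)
    (a1 a3 : F) (h1 : a1 ∈ A) (hne : a1 ≠ a3) (W : Finset F)
    (hW : W = (Lam A n).filter fun l => a1 + l * (a3 - a1) ∈ A) (t : ℝ)
    (ht : t = (A.card : ℝ) ^ 2 / n) :
    (W.card : ℝ) ^ 2 ≤ (2 + C ^ 2) * K ^ 33 * t ^ 5 * A.card ∨
    (W.card : ℝ) ≤ C * (A.card : ℝ) ^ ((3:ℝ)/5) ∨
    (Fintype.card F : ℝ) ≤ 2 * K ^ 28 * t ^ 4 * A.card := by
  have hn0 : (0 : ℝ) < n := by exact_mod_cast hn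
  have ha1 : (1 : ℝ) ≤ A.card := by exact_mod_cast hA.card_pos
  have ht1 : 1 ≤ t := by
    rw [ht, le_div_iff₀ hn0, one_mul]; exact_mod_cast hna
  have hK0 : 0 < K := by linarith
  have hτ : 1 ≤ K ^ 5 * t := one_le_mul_of_one_le_of_one_le (one_le_pow₀ hK1) ht1
  have hWL : ∀ w ∈ W, w ≠ 0 ∧ n ≤ ncount A w ∧ a1 + w * (a3 - a1) ∈ A := by
    intro w hw
    rw [hW] at hw
    simp only [Lam, Finset.mem_filter, Finset.mem_univ, true_and] at hw
    exact ⟨hw.1.1, hw.1.2, hw.2⟩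
  obtain ⟨b1, b2, b3⟩ := dil_bounds A W (K ^ 8 * A.card) (K ^ 5 * t) (a3 - a1)
    (sub_ne_zero.2 hne.symm) hA hτ (plu A hA K hK 4 4) (fun w hw => by
      have := Finset.sub_mem_sub (hWL w hw).2.2 h1
      rwa [add_sub_cancel_left, mul_comm] at this) (fun w hw => by
      obtain ⟨S, hS, hS'⟩ := cover A hA K hK w n hn (hWL w hw).2.1
      refine ⟨S, ?_, hS'⟩
      rw [ht, ← mul_div_assoc, le_div_iff₀ hn0]
      exact hS)
  have c2 : 1 ≤ 2 + C ^ 2 := by nlinarith [sq_nonneg C]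
  -- it suffices to bound by `τ ^ 5 * c`
  have e45 : (K ^ 5 * t) ^ 4 * (K ^ 8 * A.card) ≤ (K ^ 5 * t) ^ 5 * (K ^ 8 * A.card) := by
    gcongr
    norm_num
  have fin1 : (W.card : ℝ) ^ 2 ≤ (2 + C ^ 2) * ((K ^ 5 * t) ^ 5 * (K ^ 8 * A.card)) →
      (W.card : ℝ) ^ 2 ≤ (2 + C ^ 2) * K ^ 33 * t ^ 5 * A.card := by
    intro h; refine h.trans (le_of_eq ?_); ring
  have hP0 : 0 ≤ (K ^ 5 * t) ^ 5 * (K ^ 8 * A.card) := by positivity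
  have fin2 : (W.card : ℝ) ^ 2 ≤ (K ^ 5 * t) ^ 5 * (K ^ 8 * A.card) →
      (W.card : ℝ) ^ 2 ≤ (2 + C ^ 2) * K ^ 33 * t ^ 5 * A.card := fun h =>
    fin1 (h.trans (le_mul_of_one_le_left hP0 c2))
  by_cases hW2 : 2 ≤ W.card
  swap
  · left
    apply fin2
    have : (W.card : ℝ) ≤ 1 := by exact_mod_cast (by omega : W.card ≤ 1)
    have h2 : 1 ≤ (K ^ 5 * t) ^ 5 * (K ^ 8 * A.card) :=
      one_le_mul_of_one_le_of_one_le (one_le_pow₀ hτ)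
        (one_le_mul_of_one_le_of_one_le (one_le_pow₀ hK1) ha1)
    have h3 : (W.card : ℝ) ^ 2 ≤ 1 := pow_le_one₀ (Nat.cast_nonneg _) this
    linarith
  by_cases hadd : ∀ r ∈ quotSet W, 1 + r ∈ quotSet W
  swap
  · left
    push Not at hadd
    obtain ⟨r, hr, hr'⟩ := hadd
    have h := b2 r hr
    rw [dil_card_of_notMem W _ hr'] at h
    push_cast at h
    exact fin2 (h.trans e45)
  by_cases hmul : ∀ w ∈ W, ∀ r ∈ quotSet W, w * r ∈ quotSet W
  swap
  · left
    push Not at hmul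
    obtain ⟨w, hw, r, hr, hr'⟩ := hmul
    have h := b3 w hw r hr
    rw [dil_card_of_notMem W _ hr'] at h
    push_cast at h
    exact fin2 h
  obtain ⟨G, hWG, hGR⟩ := exists_field W (fun w hw => (hWL w hw).1) hW2 hadd hmul
  obtain ⟨ξ, hξ, hle⟩ := exists_dil W G
  have hb := b1 ξ (hGR ξ hξ)
  set B4 : ℝ := (K ^ 5 * t) ^ 4 * (K ^ 8 * A.card) with hB4
  have hB40 : 0 ≤ B4 := by positivity
  set y : ℝ := (W.card : ℝ) with hy
  have hy0 : 0 < y := by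
    rw [hy]; exact_mod_cast (by omega : 0 < W.card)
  set g : ℝ := (Nat.card G : ℝ) with hg
  have hg0 : 0 < g := by
    rw [hg]; exact_mod_cast Nat.card_pos
  have hmain : y ^ 2 * g ≤ B4 * (g + y ^ 2) := by
    have h : y ^ 4 * g ≤ (dil W ξ).card * (y ^ 2 * g + y ^ 4) := by
      rw [hy, hg]; exact_mod_cast hle
    have h' : y ^ 4 * g ≤ B4 * (y ^ 2 * g + y ^ 4) := h.trans (by gcongr)
    have : y ^ 2 * (y ^ 2 * g) ≤ y ^ 2 * (B4 * (g + y ^ 2)) := by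
      nlinarith
    exact le_of_mul_le_mul_left this (by positivity)
  by_cases hGt : G = ⊤
  · have hgq : g = Fintype.card F := by
      rw [hg, hGt, ← Nat.card_eq_fintype_card]
      congr 1
      exact Nat.card_congr Subfield.topEquiv.toEquiv
    by_cases hyq : y ^ 2 ≤ g
    · left
      apply fin1
      have h1 : y ^ 2 * g ≤ (2 * B4) * g := by nlinarith
      have h2 := le_of_mul_le_mul_right h1 hg0
      nlinarith [sq_nonneg C]
    · right; right
      push Not at hyq
      have h1 : g * y ^ 2 ≤ (2 * B4) * y ^ 2 := by nlinarith
      have h2 := le_of_mul_le_mul_right h1 (by positivity)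
      rw [← hgq]
      refine h2.trans (le_of_eq ?_)
      rw [hB4]; ring
  · have h := hsub G hGt (a3 - a1) a1
    have h3 : y ≤ C * max (g ^ ((1:ℝ)/2)) ((A.card : ℝ) ^ ((3:ℝ)/5)) := by
      refine le_trans ?_ h
      rw [hy, Nat.cast_le]
      refine Finset.card_le_card_of_injOn (fun w => a1 + w * (a3 - a1)) ?_ ?_
      · intro w hw
        simp only [Finset.coe_filter, Set.mem_ofPred_eq]
        exact ⟨(hWL w hw).2.2, w, hWG w hw, by ring⟩
      · intro w _ w' _ heq
        simp only [add_right_inj] at heq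
        exact mul_right_cancel₀ (sub_ne_zero.2 hne.symm) heq
    rcases le_total (g ^ ((1:ℝ)/2)) ((A.card : ℝ) ^ ((3:ℝ)/5)) with hm | hm
    · right; left
      rwa [max_eq_right hm] at h3
    · left
      rw [max_eq_left hm] at h3
      apply fin1
      have h4 : y ^ 2 ≤ C ^ 2 * g := by
        calc y ^ 2 ≤ (C * g ^ ((1:ℝ)/2)) ^ 2 := by gcongr
          _ = C ^ 2 * g := by
            rw [mul_pow, ← Real.sqrt_eq_rpow, Real.sq_sqrt hg0.le]
      have h1 : y ^ 2 * g ≤ ((1 + C ^ 2) * B4) * g := by nlinarith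
      have h2 := le_of_mul_le_mul_right h1 hg0
      nlinarith [sq_nonneg C]

lemma key [Fintype F] (C K : ℝ) (hC : 0 < C) (hK1 : 1 ≤ K) (A : Finset F)
    (hA : A.Nonempty) (hK : ((A + A).card : ℝ) ≤ K * A.card)
    (hsub : subfieldCond A C ((A.card : ℝ) ^ ((3:ℝ)/5))) (n : ℕ) (hn : 1 ≤ n) :
    ((Lam A n).card : ℝ) * (n : ℝ) ^ 2 ≤ ((2 + C ^ 2) * K ^ 33 + C + 2 * K ^ 28) *
      ((A.card : ℝ) ^ ((5:ℝ) - 1/5) +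
        (Fintype.card F : ℝ) ^ (-(1:ℝ)/4) * (A.card : ℝ) ^ ((5:ℝ) + 1/4)) := by
  have ha1 : (1 : ℝ) ≤ A.card := by exact_mod_cast hA.card_pos
  have hK0 : 0 < K := by linarith
  have hq0 : (0 : ℝ) < Fintype.card F := by exact_mod_cast Fintype.card_pos
  rcases (Lam A n).eq_empty_or_nonempty with hL | hL
  · rw [hL]; simp; positivity
  have hna : n ≤ A.card ^ 2 := by
    obtain ⟨l, hl⟩ := hL
    simp only [Lam, Finset.mem_filter] at hl
    exact hl.2.2.trans (ncount_le_sq A l)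
  obtain ⟨a1, h1, a3, h3, hne, hle⟩ := exists_W A hA n hn hL
  have htri := trichotomy C K hC hK1 A hA hK hsub n hn hna a1 a3 h1 hne _ rfl _ rfl
  set W := (Lam A n).filter fun l => a1 + l * (a3 - a1) ∈ A
  have hm1 : ((Lam A n).card : ℝ) * n ≤ (A.card : ℝ) ^ 3 := by exact_mod_cast Lam_mul_le A n
  have hm2 : ((Lam A n).card : ℝ) * n ≤ (A.card : ℝ) ^ 2 * W.card := by exact_mod_cast hle
  have hna' : (n : ℝ) ≤ (A.card : ℝ) ^ 2 := by exact_mod_cast hna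
  have hn0 : (0 : ℝ) < n := by exact_mod_cast hn
  have hm0 : (0 : ℝ) ≤ (Lam A n).card := Nat.cast_nonneg _
  have hy0 : (0 : ℝ) ≤ W.card := Nat.cast_nonneg _
  generalize ((Lam A n).card : ℝ) = m at *
  generalize (W.card : ℝ) = y at *
  generalize (A.card : ℝ) = a at *
  generalize (n : ℝ) = n at *
  generalize (Fintype.card F : ℝ) = q at *
  have ha0 : 0 < a := by linarith
  set B := (2 + C ^ 2) * K ^ 33 with hB
  obtain ⟨D, hD⟩ : ∃ D, D = 2 * K ^ 28 := ⟨_, rfl⟩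
  rw [← hD] at htri ⊢
  have hB1 : 1 ≤ B := one_le_mul_of_one_le_of_one_le (by nlinarith [sq_nonneg C]) (one_le_pow₀ hK1)
  have hD1 : 1 ≤ D := hD ▸ one_le_mul_of_one_le_of_one_le (by norm_num) (one_le_pow₀ hK1)
  have hX0 : 0 ≤ a ^ ((5:ℝ) - 1/5) := by positivity
  have hY0 : 0 ≤ q ^ (-(1:ℝ)/4) * a ^ ((5:ℝ) + 1/4) := by positivity
  have finX : ∀ b : ℝ, 0 ≤ b → b ≤ B + C + D → m * n ^ 2 ≤ b * a ^ ((5:ℝ) - 1/5) →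
      m * n ^ 2 ≤ (B + C + D) * (a ^ ((5:ℝ) - 1/5) + q ^ (-(1:ℝ)/4) * a ^ ((5:ℝ) + 1/4)) := by
    intro b hb hb' h
    refine h.trans ?_
    gcongr
    linarith
  have finY : ∀ b : ℝ, 0 ≤ b → b ≤ B + C + D →
      m * n ^ 2 ≤ b * (q ^ (-(1:ℝ)/4) * a ^ ((5:ℝ) + 1/4)) →
      m * n ^ 2 ≤ (B + C + D) * (a ^ ((5:ℝ) - 1/5) + q ^ (-(1:ℝ)/4) * a ^ ((5:ℝ) + 1/4)) := by
    intro b hb hb' h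
    refine h.trans ?_
    gcongr
    linarith
  rcases htri with h | h | h
  · apply finX B (by linarith) (by linarith)
    have e1 : y ^ 2 * n ^ 5 ≤ B * a ^ 11 := by
      calc y ^ 2 * n ^ 5 ≤ (B * (a ^ 2 / n) ^ 5 * a) * n ^ 5 := by gcongr
        _ = B * a ^ 11 := by field_simp
    have e2 : (m * n) ^ 2 ≤ (a ^ 2 * y) ^ 2 := by gcongr
    have e3 : (m * n) ^ 3 ≤ (a ^ 3) ^ 3 := by gcongr
    have e4 : (m * n ^ 2) ^ 5 ≤ B * a ^ 24 := by
      calc (m * n ^ 2) ^ 5 = (m * n) ^ 2 * (m * n) ^ 3 * n ^ 5 := by ring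
        _ ≤ (a ^ 2 * y) ^ 2 * (a ^ 3) ^ 3 * n ^ 5 := by gcongr
        _ = a ^ 13 * (y ^ 2 * n ^ 5) := by ring
        _ ≤ a ^ 13 * (B * a ^ 11) := by gcongr
        _ = _ := by ring
    have e5 : (B * a ^ ((5:ℝ) - 1/5)) ^ 5 = B ^ 5 * a ^ 24 := by
      rw [mul_pow, ← Real.rpow_natCast (a ^ ((5:ℝ) - 1/5)), ← Real.rpow_mul ha0.le,
        ← Real.rpow_natCast a 24]
      norm_num
    have e6 : B ≤ B ^ 5 := le_self_pow₀ hB1 (by norm_num)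
    refine le_of_pow_le_pow_left₀ (n := 5) (by norm_num) (by positivity) ?_
    rw [e5]
    refine e4.trans ?_
    gcongr
  · apply finX C hC.le (by linarith)
    calc m * n ^ 2 = (m * n) * n := by ring
      _ ≤ (a ^ 2 * y) * a ^ 2 := by gcongr
      _ ≤ (a ^ 2 * (C * a ^ ((3:ℝ)/5))) * a ^ 2 := by gcongr
      _ = C * (a ^ (4:ℝ) * a ^ ((3:ℝ)/5)) := by
        have : a ^ (4:ℝ) = a ^ 4 := by exact_mod_cast Real.rpow_natCast a 4
        rw [this]; ring
      _ = C * a ^ ((4:ℝ) + 3/5) := by rw [Real.rpow_add ha0]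
      _ ≤ C * a ^ ((5:ℝ) - 1/5) := by
        gcongr
        norm_num
  · apply finY D (by linarith) (by linarith)
    have e1 : q * n ^ 4 ≤ D * a ^ 9 := by
      calc q * n ^ 4 ≤ (D * (a ^ 2 / n) ^ 4 * a) * n ^ 4 := by gcongr
        _ = _ := by field_simp
    have e4 : (m * n ^ 2) ^ 4 * q ≤ D * a ^ 21 := by
      calc (m * n ^ 2) ^ 4 * q = (m * n) ^ 4 * (q * n ^ 4) := by ring
        _ ≤ (a ^ 3) ^ 4 * (D * a ^ 9) := by gcongr
        _ = _ := by ring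
    have e5 : (D * (q ^ (-(1:ℝ)/4) * a ^ ((5:ℝ) + 1/4))) ^ 4 = D ^ 4 * a ^ 21 / q := by
      rw [mul_pow, mul_pow, ← Real.rpow_natCast (a ^ ((5:ℝ) + 1/4)), ← Real.rpow_mul ha0.le,
        ← Real.rpow_natCast (q ^ (-(1:ℝ)/4)), ← Real.rpow_mul hq0.le, ← Real.rpow_natCast a 21]
      norm_num
      rw [Real.rpow_neg_one]
      field_simp
    have e6 : D ≤ D ^ 4 := le_self_pow₀ hD1 (by norm_num)
    refine le_of_pow_le_pow_left₀ (n := 4) (by norm_num) (by positivity) ?_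
    rw [e5, le_div_iff₀ hq0]
    refine e4.trans ?_
    gcongr

lemma triples_le [Fintype F] (A : Finset F) :
    collinearTriples A A ≤ ∑ l : F, ncount A l ^ 2 + 3 * A.card ^ 4 := by
  set U := (A ×ˢ A ×ˢ A) ×ˢ (A ×ˢ A ×ˢ A) with hU
  set M := U.filter fun x => x.1.2.2 ≠ x.1.1 ∧ x.2.2.2 ≠ x.2.1 ∧
    (x.1.2.1 - x.1.1) * (x.2.2.2 - x.2.1) = (x.1.2.2 - x.1.1) * (x.2.2.1 - x.2.1) with hM
  set D1 := U.filter fun x => x.1.2.2 = x.1.1 ∧ x.1.2.1 = x.1.1 with hD1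
  set D2 := U.filter fun x => x.1.2.2 = x.1.1 ∧ x.2.2.2 = x.2.1 with hD2
  set D3 := U.filter fun x => x.2.2.2 = x.2.1 ∧ x.2.2.1 = x.2.1 with hD3
  have hsub : (U.filter fun x =>
    (x.1.2.1 - x.1.1) * (x.2.2.2 - x.2.1) = (x.1.2.2 - x.1.1) * (x.2.2.1 - x.2.1)) ⊆
      M ∪ (D1 ∪ (D2 ∪ D3)) := by
    intro x hx
    simp only [hM, hD1, hD2, hD3, Finset.mem_union, Finset.mem_filter] at hx ⊢
    obtain ⟨hxU, he⟩ := hx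
    by_cases h1 : x.1.2.2 = x.1.1
    · by_cases h2 : x.2.2.2 = x.2.1
      · exact Or.inr (Or.inr (Or.inl ⟨hxU, h1, h2⟩))
      · refine Or.inr (Or.inl ⟨hxU, h1, ?_⟩)
        rw [h1, sub_self, zero_mul, mul_eq_zero] at he
        rcases he with he | he
        · exact sub_eq_zero.1 he
        · exact absurd (sub_eq_zero.1 he) h2
    · by_cases h2 : x.2.2.2 = x.2.1
      · refine Or.inr (Or.inr (Or.inr ⟨hxU, h2, ?_⟩))
        rw [h2, sub_self, mul_zero, eq_comm, mul_eq_zero] at he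
        rcases he with he | he
        · exact absurd (sub_eq_zero.1 he) h1
        · exact sub_eq_zero.1 he
      · exact Or.inl ⟨hxU, h1, h2, he⟩
  have c4 : ((A ×ˢ A) ×ˢ (A ×ˢ A)).card = A.card ^ 4 := by
    simp only [Finset.card_product]; ring
  have b1 : D1.card ≤ A.card ^ 4 := by
    rw [← c4]
    refine Finset.card_le_card_of_injOn (fun x => ((x.1.1, x.2.1), (x.2.2.1, x.2.2.2))) ?_ ?_
    · rintro ⟨⟨a1, a2, a3⟩, b1, b2, b3⟩ h
      simp [hD1, hU] at h ⊢
      tauto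
    · rintro ⟨⟨a1, a2, a3⟩, b1, b2, b3⟩ h ⟨⟨a1', a2', a3'⟩, b1', b2', b3'⟩ h' heq
      simp [hD1, hU] at h h' heq ⊢
      grind
  have b2 : D2.card ≤ A.card ^ 4 := by
    rw [← c4]
    refine Finset.card_le_card_of_injOn (fun x => ((x.1.1, x.2.1), (x.1.2.1, x.2.2.1))) ?_ ?_
    · rintro ⟨⟨a1, a2, a3⟩, b1, b2, b3⟩ h
      simp [hD2, hU] at h ⊢
      tauto
    · rintro ⟨⟨a1, a2, a3⟩, b1, b2, b3⟩ h ⟨⟨a1', a2', a3'⟩, b1', b2', b3'⟩ h' heq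
      simp [hD2, hU] at h h' heq ⊢
      grind
  have b3 : D3.card ≤ A.card ^ 4 := by
    rw [← c4]
    refine Finset.card_le_card_of_injOn (fun x => ((x.1.1, x.2.1), (x.1.2.1, x.1.2.2))) ?_ ?_
    · rintro ⟨⟨a1, a2, a3⟩, b1, b2, b3⟩ h
      simp [hD3, hU] at h ⊢
      tauto
    · rintro ⟨⟨a1, a2, a3⟩, b1, b2, b3⟩ h ⟨⟨a1', a2', a3'⟩, b1', b2', b3'⟩ h' heq
      simp [hD3, hU] at h h' heq ⊢
      grind
  have bM : M.card ≤ ∑ l : F, ncount A l ^ 2 := by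
    rw [Finset.card_eq_sum_card_fiberwise (f := fun x : (F × F × F) × (F × F × F) =>
      (x.1.2.1 - x.1.1) / (x.1.2.2 - x.1.1)) (t := Finset.univ) (fun _ _ => by simp)]
    refine Finset.sum_le_sum fun l _ => ?_
    unfold ncount
    rw [sq, ← Finset.card_product]
    apply Finset.card_le_card
    rintro ⟨⟨a1, a2, a3⟩, b1, b2, b3⟩ h
    simp only [hM, hU, Finset.mem_filter, Finset.mem_product] at h ⊢
    obtain ⟨⟨⟨hA, hB⟩, h1, h2, h3⟩, h4⟩ := h
    have h1' := sub_ne_zero.2 h1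
    rw [div_eq_iff h1'] at h4
    refine ⟨⟨hA, h1, h4⟩, hB, h2, ?_⟩
    apply mul_left_cancel₀ h1'
    rw [← h3, h4]; ring
  unfold collinearTriples
  calc _ ≤ (M ∪ (D1 ∪ (D2 ∪ D3))).card := Finset.card_le_card hsub
    _ ≤ M.card + (D1.card + (D2.card + D3.card)) :=
      (Finset.card_union_le _ _).trans (Nat.add_le_add_left ((Finset.card_union_le _ _).trans
        (Nat.add_le_add_left (Finset.card_union_le _ _) _)) _)
    _ ≤ _ := by omega

lemma sq_le_layers (N M : ℕ) (h : N ≤ M) :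
    N ^ 2 ≤ ∑ n ∈ Finset.Icc 1 M, if n ≤ N then 2 * n else 0 := by
  have h1 : ∀ N : ℕ, N ^ 2 ≤ ∑ n ∈ Finset.Icc 1 N, 2 * n := by
    intro N
    induction N with
    | zero => simp
    | succ k ih =>
      rw [Finset.sum_Icc_succ_top (by omega)]
      nlinarith
  refine (h1 N).trans ?_
  rw [← Finset.sum_filter]
  apply Finset.sum_le_sum_of_subset
  intro x hx
  simp only [Finset.mem_Icc, Finset.mem_filter] at hx ⊢
  omega

lemma sum_sq_le_layers [Fintype F] (A : Finset F) :
    ∑ l : F, ncount A l ^ 2 ≤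
      ∑ n ∈ Finset.Icc 1 (A.card ^ 2), 2 * n * (Lam A n).card + A.card ^ 4 := by
  rw [← Finset.sum_erase_add _ _ (Finset.mem_univ (0 : F))]
  apply Nat.add_le_add
  · calc ∑ l ∈ Finset.univ.erase (0 : F), ncount A l ^ 2
        ≤ ∑ l ∈ Finset.univ.erase (0 : F), ∑ n ∈ Finset.Icc 1 (A.card ^ 2),
          (if n ≤ ncount A l then 2 * n else 0) :=
          Finset.sum_le_sum fun l _ => sq_le_layers _ _ (ncount_le_sq A l)
      _ = ∑ n ∈ Finset.Icc 1 (A.card ^ 2), ∑ l ∈ Finset.univ.erase (0 : F),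
          (if n ≤ ncount A l then 2 * n else 0) := Finset.sum_comm
      _ = _ := by
        refine Finset.sum_congr rfl fun n _ => ?_
        rw [← Finset.sum_filter, Finset.sum_const, smul_eq_mul, mul_comm]
        congr 2
        ext l
        simp [Lam]
  · calc ncount A 0 ^ 2 ≤ (A.card ^ 2) ^ 2 := Nat.pow_le_pow_left (ncount_le_sq A 0) 2
      _ = _ := by ring

lemma partI [Fintype F] (C K : ℝ) (hC : 0 < C) (hK1 : 1 ≤ K) (A : Finset F)
    (hA : 2 ≤ A.card) (hK : ((A + A).card : ℝ) ≤ K * A.card)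
    (hsub : subfieldCond A C ((A.card : ℝ) ^ ((3:ℝ)/5))) :
    (collinearTriples A A : ℝ) ≤
      (8 * ((2 + C ^ 2) * K ^ 33 + C + 2 * K ^ 28) + 8) * Real.log (A.card : ℝ) *
        ((A.card : ℝ) ^ ((5:ℝ) - 1/5) +
          (Fintype.card F : ℝ) ^ (-(1:ℝ)/4) * (A.card : ℝ) ^ ((5:ℝ) + 1/4)) := by
  have hne : A.Nonempty := Finset.card_pos.1 (by omega)
  have hkey := key C K hC hK1 A hne hK hsub
  have hK0 : 0 < K := by linarith
  set c1 := (2 + C ^ 2) * K ^ 33 + C + 2 * K ^ 28 with hc1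
  have hc10 : 0 ≤ c1 := by positivity
  have ha2 : (2 : ℝ) ≤ A.card := by exact_mod_cast hA
  set X := ((A.card : ℝ) ^ ((5:ℝ) - 1/5) +
          (Fintype.card F : ℝ) ^ (-(1:ℝ)/4) * (A.card : ℝ) ^ ((5:ℝ) + 1/4)) with hX
  have ha4 : (A.card : ℝ) ^ 4 ≤ X := by
    have h1 : (A.card : ℝ) ^ 4 = (A.card : ℝ) ^ (4 : ℝ) := by
      rw [← Real.rpow_natCast]; norm_num
    have h2 : (A.card : ℝ) ^ (4 : ℝ) ≤ (A.card : ℝ) ^ ((5:ℝ) - 1/5) :=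
      Real.rpow_le_rpow_of_exponent_le (by linarith) (by norm_num)
    have h3 : 0 ≤ (Fintype.card F : ℝ) ^ (-(1:ℝ)/4) * (A.card : ℝ) ^ ((5:ℝ) + 1/4) := by positivity
    rw [hX, h1]; linarith
  have hX0 : 0 ≤ X := le_trans (by positivity) ha4
  have hlog : 1 ≤ 2 * Real.log (A.card : ℝ) := by
    have := Real.log_le_log (by norm_num) ha2
    have := Real.log_two_gt_d9
    linarith
  have h1 : ((∑ n ∈ Finset.Icc 1 (A.card ^ 2), 2 * n * (Lam A n).card : ℕ) : ℝ) ≤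
      2 * c1 * X * (1 + 2 * Real.log A.card) := by
    have hh : ((harmonic (A.card ^ 2) : ℚ) : ℝ) ≤ 1 + 2 * Real.log A.card := by
      refine (harmonic_le_one_add_log _).trans ?_
      push_cast
      rw [Real.log_pow]; norm_num
    calc ((∑ n ∈ Finset.Icc 1 (A.card ^ 2), 2 * n * (Lam A n).card : ℕ) : ℝ)
        = ∑ n ∈ Finset.Icc 1 (A.card ^ 2), 2 * (n : ℝ) * (Lam A n).card := by push_cast; rfl
      _ ≤ ∑ n ∈ Finset.Icc 1 (A.card ^ 2), 2 * c1 * X * (n : ℝ)⁻¹ := by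
        refine Finset.sum_le_sum fun n hn => ?_
        have hn1 := (Finset.mem_Icc.1 hn).1
        have hn0 : (0 : ℝ) < n := by exact_mod_cast hn1
        rw [← div_eq_mul_inv, le_div_iff₀ hn0]
        nlinarith [hkey n hn1]
      _ = 2 * c1 * X * ((harmonic (A.card ^ 2) : ℚ) : ℝ) := by
        rw [← Finset.mul_sum, harmonic_eq_sum_Icc]
        push_cast; rfl
      _ ≤ _ := by gcongr
  have h2 : (collinearTriples A A : ℝ) ≤
      ((∑ n ∈ Finset.Icc 1 (A.card ^ 2), 2 * n * (Lam A n).card : ℕ) : ℝ) + 4 * (A.card : ℝ) ^ 4 := by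
    have := (triples_le A).trans (Nat.add_le_add_right (sum_sq_le_layers A) _)
    have h' : collinearTriples A A ≤ (∑ n ∈ Finset.Icc 1 (A.card ^ 2), 2 * n * (Lam A n).card) +
      4 * A.card ^ 4 := by omega
    exact_mod_cast h'
  have h3 : 2 * c1 * X * (1 + 2 * Real.log A.card) ≤ 2 * c1 * X * (4 * Real.log A.card) := by
    gcongr; linarith
  have h4 : 4 * (A.card : ℝ) ^ 4 ≤ 8 * Real.log A.card * X := by nlinarith
  calc _ ≤ _ := h2
    _ ≤ 2 * c1 * X * (4 * Real.log A.card) + 8 * Real.log A.card * X := by linarith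
    _ = _ := by ring

lemma line_eq (l : Set (F × F)) (hl : IsLine l) (p1 p2 : F × F) (h1 : p1 ∈ l) (h2 : p2 ∈ l)
    (hne : p1 ≠ p2) :
    l = {p | (p2.1 - p1.1) * (p.2 - p1.2) = (p.1 - p1.1) * (p2.2 - p1.2)} := by
  obtain ⟨a, b, c, hab, rfl⟩ := hl
  obtain ⟨x1, y1⟩ := p1
  obtain ⟨x2, y2⟩ := p2
  simp only [Set.mem_ofPred_eq] at h1 h2
  ext ⟨x, y⟩
  simp only [Set.mem_ofPred_eq]
  have hu : a * (x2 - x1) + b * (y2 - y1) = 0 := by linear_combination h2 - h1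
  constructor
  · intro h
    have hv : a * (x - x1) + b * (y - y1) = 0 := by linear_combination h - h1
    by_cases ha : a = 0
    · have hb : b ≠ 0 := by rintro rfl; exact hab (by rw [ha])
      apply mul_left_cancel₀ hb
      linear_combination (x2 - x1) * hv - (x - x1) * hu
    · apply mul_left_cancel₀ ha
      linear_combination (y - y1) * hu - (y2 - y1) * hv
  · intro h
    suffices hv : a * (x - x1) + b * (y - y1) = 0 by linear_combination hv + h1
    by_cases hx : x2 - x1 = 0
    · have hy : y2 - y1 ≠ 0 := by
        intro hy
        apply hne
        rw [sub_eq_zero.1 hx, sub_eq_zero.1 hy]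
      apply mul_left_cancel₀ hy
      rw [mul_zero]
      linear_combination (y - y1) * hu - a * h
    · apply mul_left_cancel₀ hx
      rw [mul_zero]
      linear_combination (x - x1) * hu + b * h

lemma sum_triples_le (A : Finset F) (L : Finset (Set (F × F))) (hL : ∀ l ∈ L, IsLine l) :
    ∑ l ∈ L, ((A ×ˢ A).filter (· ∈ l)).card * (((A ×ˢ A).filter (· ∈ l)).card *
      (((A ×ˢ A).filter (· ∈ l)).card - 1)) ≤ collinearTriples A A := by
  set U := (A ×ˢ A ×ˢ A) ×ˢ (A ×ˢ A ×ˢ A) with hU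
  let R : Set (F × F) → (F × F × F) × (F × F × F) → Prop := fun l x =>
    (x.1.1, x.2.1) ≠ (x.1.2.1, x.2.2.1) ∧ (x.1.1, x.2.1) ∈ l ∧ (x.1.2.1, x.2.2.1) ∈ l ∧
      (x.1.2.2, x.2.2.2) ∈ l
  have h1 : ∀ l ∈ L, ((A ×ˢ A).filter (· ∈ l)).card * (((A ×ˢ A).filter (· ∈ l)).card *
      (((A ×ˢ A).filter (· ∈ l)).card - 1)) ≤ (U.filter (R l)).card := by
    intro l _
    set Q := (A ×ˢ A).filter (· ∈ l) with hQ
    have : (Q ×ˢ Q.offDiag).card = Q.card * (Q.card * (Q.card - 1)) := by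
      rw [Finset.card_product, Finset.offDiag_card, Nat.mul_sub_one]
    rw [← this]
    refine Finset.card_le_card_of_injOn
      (fun p => ((p.2.1.1, p.2.2.1, p.1.1), (p.2.1.2, p.2.2.2, p.1.2))) ?_ ?_
    · rintro ⟨⟨a, b⟩, ⟨c, d⟩, e, f⟩ h
      simp only [Finset.coe_product, Set.mem_prod, Finset.mem_coe, Finset.mem_offDiag, hQ,
        Finset.mem_filter, Finset.mem_product, hU, R] at h ⊢
      tauto
    · rintro ⟨⟨a, b⟩, ⟨c, d⟩, e, f⟩ h ⟨⟨a', b'⟩, ⟨c', d'⟩, e', f'⟩ h' heq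
      simp only [Prod.mk.injEq] at heq ⊢
      tauto
  refine (Finset.sum_le_sum h1).trans ?_
  simp only [Finset.card_filter]
  rw [Finset.sum_comm]
  unfold collinearTriples
  rw [Finset.card_filter]
  refine Finset.sum_le_sum ?_
  rintro ⟨⟨a1, a2, a3⟩, b1, b2, b3⟩ _
  rw [← Finset.card_filter]
  split_ifs with h
  · rw [Finset.card_le_one]
    intro l hl l' hl'
    simp only [Finset.mem_filter, R] at hl hl'
    rw [line_eq l (hL l hl.1) _ _ hl.2.2.1 hl.2.2.2.1 hl.2.1,
      line_eq l' (hL l' hl'.1) _ _ hl'.2.2.1 hl'.2.2.2.1 hl.2.1]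
  · rw [Nat.le_zero, Finset.card_eq_zero, Finset.filter_eq_empty_iff]
    intro l hl hR
    apply h
    simp only [R] at hR
    have h3 := hR.2.2.2
    rw [line_eq l (hL l hl) _ _ hR.2.1 hR.2.2.1 hR.1] at h3
    simpa using h3

lemma partII (A : Finset F) (L : Finset (Set (F × F))) (hL : ∀ l ∈ L, IsLine l) :
    ∃ I2 : ℝ, 0 ≤ I2 ∧ (incidences (A ×ˢ A) L : ℝ) ≤ I2 + L.card ∧
      I2 ^ 3 ≤ (L.card : ℝ) ^ 2 * (2 * collinearTriples A A) := by
  set i : Set (F × F) → ℕ := fun l => ((A ×ˢ A).filter (· ∈ l)).card with hi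
  have hinc : incidences (A ×ˢ A) L = ∑ l ∈ L, i l := by
    unfold incidences
    simp only [hi, Finset.card_filter]
    rw [Finset.sum_product, Finset.sum_comm]
  set L2 := L.filter fun l => 2 ≤ i l with hL2
  refine ⟨((∑ l ∈ L2, i l : ℕ) : ℝ), Nat.cast_nonneg _, ?_, ?_⟩
  · rw [hinc]
    norm_cast
    rw [← Finset.sum_filter_add_sum_filter_not L (fun l => 2 ≤ i l)]
    apply Nat.add_le_add_left
    calc ∑ l ∈ L.filter (fun l => ¬ 2 ≤ i l), i l ≤ ∑ l ∈ L.filter (fun l => ¬ 2 ≤ i l), 1 := by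
          refine Finset.sum_le_sum fun l hl => ?_
          simp only [Finset.mem_filter] at hl
          omega
      _ ≤ L.card := by simpa using Finset.card_filter_le _ _
  · have h1 : ∑ l ∈ L2, i l * (i l * (i l - 1)) ≤ collinearTriples A A :=
      sum_triples_le A L2 fun l hl => hL l (Finset.mem_filter.1 hl).1
    have h2 : ∑ l ∈ L2, i l ^ 3 ≤ 2 * collinearTriples A A := by
      refine le_trans ?_ (Nat.mul_le_mul_left 2 h1)
      rw [Finset.mul_sum]
      refine Finset.sum_le_sum fun l hl => ?_
      have : 2 ≤ i l := (Finset.mem_filter.1 hl).2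
      obtain ⟨k, hk⟩ := Nat.exists_eq_add_of_le this
      rw [hk]
      have : 2 + k - 1 = 1 + k := by omega
      rw [this]
      nlinarith [sq_nonneg k]
    have h3 : (∑ l ∈ L2, (i l : ℝ)) ^ 3 ≤ (L2.card : ℝ) ^ 2 * ∑ l ∈ L2, (i l : ℝ) ^ 3 := by
      rcases L2.eq_empty_or_nonempty with he | hne
      · rw [he]; simp
      · have := pow_sum_div_card_le_sum_pow (s := L2) (f := fun l => (i l : ℝ)) (n := 2)
          (fun _ _ => Nat.cast_nonneg _)
        have hc : (0 : ℝ) < (L2.card : ℝ) ^ 2 := by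
          have : (0 : ℝ) < L2.card := by exact_mod_cast hne.card_pos
          positivity
        rw [div_le_iff₀ hc] at this
        rw [mul_comm]
        exact this
    have h4 : (L2.card : ℝ) ≤ L.card := by exact_mod_cast Finset.card_filter_le _ _
    have h5 : ∑ l ∈ L2, (i l : ℝ) ^ 3 ≤ 2 * collinearTriples A A := by exact_mod_cast h2
    rw [Nat.cast_sum]
    refine h3.trans ?_
    exact mul_le_mul (pow_le_pow_left₀ (Nat.cast_nonneg _) h4 2) h5
      (Finset.sum_nonneg fun _ _ => by positivity) (by positivity)

lemma partIII [Fintype F] (A : Finset F) (hA : 2 ≤ A.card) :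
    ((A.card : ℝ) ^ 4 / 2) ^ 3 ≤ (numLines (A ×ˢ A) : ℝ) * (collinearTriples A A : ℝ) ^ 2 := by
  set i : Set (F × F) → ℕ := fun l => ((A ×ˢ A).filter (· ∈ l)).card with hi
  set L := linesOf (A ×ˢ A) with hLdef
  have hmem : ∀ l, l ∈ L ↔ IsLine l ∧ 2 ≤ i l := by
    intro l
    simp [hLdef, linesOf, hi]
  have hN : numLines (A ×ˢ A) = L.card := by
    unfold numLines
    rw [hLdef, linesOf, Set.ncard_eq_toFinset_card _ (Set.toFinite _)]
  have hT : ∑ l ∈ L, i l * (i l * (i l - 1)) ≤ collinearTriples A A :=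
    sum_triples_le A L fun l hl => ((hmem l).1 hl).1
  have hpairs : (A ×ˢ A).offDiag.card ≤ ∑ l ∈ L, i l * (i l - 1) := by
    have h1 : (A ×ˢ A).offDiag ⊆ L.biUnion fun l => ((A ×ˢ A).filter (· ∈ l)).offDiag := by
      rintro ⟨⟨x1, y1⟩, x2, y2⟩ hp
      rw [Finset.mem_offDiag] at hp
      obtain ⟨h1, h2, hne⟩ := hp
      simp only at h1 h2 hne
      have hline : IsLine {p : F × F | (y2 - y1) * p.1 + (x1 - x2) * p.2 =
          (y2 - y1) * x1 + (x1 - x2) * y1} := by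
        refine ⟨_, _, _, ?_, rfl⟩
        intro h
        simp only [Prod.mk.injEq] at h
        apply hne
        rw [sub_eq_zero.1 h.2, sub_eq_zero.1 h.1]
      have hp1 : (x1, y1) ∈ {p : F × F | (y2 - y1) * p.1 + (x1 - x2) * p.2 =
          (y2 - y1) * x1 + (x1 - x2) * y1} := by simp
      have hp2 : (x2, y2) ∈ {p : F × F | (y2 - y1) * p.1 + (x1 - x2) * p.2 =
          (y2 - y1) * x1 + (x1 - x2) * y1} := by
        simp only [Set.mem_ofPred_eq]; ring
      generalize {p : F × F | (y2 - y1) * p.1 + (x1 - x2) * p.2 =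
          (y2 - y1) * x1 + (x1 - x2) * y1} = l at *
      rw [Finset.mem_biUnion]
      refine ⟨l, (hmem l).2 ⟨hline, ?_⟩, ?_⟩
      · show 1 < ((A ×ˢ A).filter (· ∈ l)).card
        rw [Finset.one_lt_card]
        exact ⟨_, Finset.mem_filter.2 ⟨h1, hp1⟩, _, Finset.mem_filter.2 ⟨h2, hp2⟩, hne⟩
      · rw [Finset.mem_offDiag]
        exact ⟨Finset.mem_filter.2 ⟨h1, hp1⟩, Finset.mem_filter.2 ⟨h2, hp2⟩, hne⟩
    refine (Finset.card_le_card h1).trans (Finset.card_biUnion_le.trans (le_of_eq ?_))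
    refine Finset.sum_congr rfl fun l _ => ?_
    rw [Finset.offDiag_card, Nat.mul_sub, mul_one]
  rw [hN]
  -- real versions
  set f : Set (F × F) → ℝ := fun l => (i l : ℝ) * ((i l : ℝ) - 1) with hf
  set g : Set (F × F) → ℝ := fun l => (i l : ℝ) * ((i l : ℝ) * ((i l : ℝ) - 1)) with hg
  have hi1 : ∀ l ∈ L, (1 : ℝ) ≤ i l := fun l hl => by
    have := ((hmem l).1 hl).2
    exact_mod_cast (by omega : 1 ≤ i l)
  have hcast : ∀ l ∈ L, ((i l - 1 : ℕ) : ℝ) = (i l : ℝ) - 1 := fun l hl => by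
    have := ((hmem l).1 hl).2
    rw [Nat.cast_sub (by omega)]; simp
  have hT' : ∑ l ∈ L, g l ≤ collinearTriples A A := by
    refine le_trans (le_of_eq ?_) ((Nat.cast_le (α := ℝ)).2 hT)
    push_cast
    refine Finset.sum_congr rfl fun l hl => ?_
    rw [hcast l hl]
  have hp' : ((A ×ˢ A).offDiag.card : ℝ) ≤ ∑ l ∈ L, f l := by
    refine ((Nat.cast_le (α := ℝ)).2 hpairs).trans (le_of_eq ?_)
    push_cast
    refine Finset.sum_congr rfl fun l hl => ?_
    rw [hcast l hl]
  have ha2 : (2 : ℝ) ≤ A.card := by exact_mod_cast hA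
  have hoff : ((A ×ˢ A).offDiag.card : ℝ) = (A.card : ℝ) ^ 4 - (A.card : ℝ) ^ 2 := by
    rw [Finset.offDiag_card, Finset.card_product, Nat.cast_sub (Nat.le_mul_self _)]
    push_cast; ring
  have hlow : (A.card : ℝ) ^ 4 / 2 ≤ ∑ l ∈ L, f l := by
    refine le_trans ?_ hp'
    rw [hoff]
    nlinarith [mul_nonneg (sq_nonneg (A.card : ℝ)) (by nlinarith : 0 ≤ (A.card : ℝ) ^ 2 - 2)]
  have hs0 : 0 < ∑ l ∈ L, f l := lt_of_lt_of_le (by positivity) hlow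
  have cs1 : (∑ l ∈ L, f l) ^ 2 ≤ (∑ l ∈ L, g l) * ∑ l ∈ L, ((i l : ℝ) - 1) := by
    apply Finset.sum_sq_le_sum_mul_sum_of_sq_le_mul
    · intro l hl
      have := hi1 l hl
      have : 0 ≤ (i l : ℝ) - 1 := by linarith
      simp only [hg]; positivity
    · intro l hl; linarith [hi1 l hl]
    · intro l hl; simp only [hf, hg]; exact le_of_eq (by ring)
  have cs2 : (∑ l ∈ L, ((i l : ℝ) - 1)) ^ 2 ≤ L.card * ∑ l ∈ L, f l := by
    refine sq_sum_le_card_mul_sum_sq.trans ?_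
    gcongr with l hl
    simp only [hf]
    nlinarith [hi1 l hl]
  have hg0 : 0 ≤ ∑ l ∈ L, g l := Finset.sum_nonneg fun l hl => by
    have := hi1 l hl
    have : 0 ≤ (i l : ℝ) - 1 := by linarith
    simp only [hg]; positivity
  have hfin : ∀ x Sf Sg Sh N T : ℝ, 0 ≤ x → x ≤ Sf → 0 < Sf → 0 ≤ Sg → Sg ≤ T → 0 ≤ N →
      Sf ^ 2 ≤ Sg * Sh → Sh ^ 2 ≤ N * Sf → x ^ 3 ≤ N * T ^ 2 := by
    intro x Sf Sg Sh N T hx hxS hS hSg hST hN h1 h2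
    have h4 : Sf * Sf ^ 3 ≤ Sf * (N * Sg ^ 2) := by
      calc Sf * Sf ^ 3 = (Sf ^ 2) ^ 2 := by ring
        _ ≤ (Sg * Sh) ^ 2 := by gcongr
        _ = Sg ^ 2 * Sh ^ 2 := by ring
        _ ≤ Sg ^ 2 * (N * Sf) := by gcongr
        _ = _ := by ring
    have h5 := le_of_mul_le_mul_left h4 hS
    calc x ^ 3 ≤ Sf ^ 3 := by gcongr
      _ ≤ _ := h5
      _ ≤ _ := by gcongr
  exact hfin _ _ _ _ _ _ (by positivity) hlow hs0 hg0 hT' (Nat.cast_nonneg _) cs1 cs2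

theorem stmt7 : ∀ C K : ℝ, 0 < C → 0 < K → ∃ C' c' : ℝ, 0 < C' ∧ 0 < c' ∧
    ∀ (F : Type) [Field F] [Fintype F] (q : ℕ), IsPrimePow q → Fintype.card F = q →
    ∀ A : Finset F, 2 ≤ A.card →
    ((A + A).card : ℝ) ≤ K * (A.card : ℝ) →
    subfieldCond A C ((A.card : ℝ) ^ ((3:ℝ)/5)) →
    ((collinearTriples A A : ℝ) ≤
      C' * Real.log (A.card : ℝ) *
        ((A.card : ℝ) ^ ((5:ℝ) - 1/5) + (q : ℝ) ^ (-(1:ℝ)/4) * (A.card : ℝ) ^ ((5:ℝ) + 1/4))) ∧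
    (∀ L : Finset (Set (F × F)), (∀ l ∈ L, IsLine l) →
      (incidences (A ×ˢ A) L : ℝ) ≤
        C' * ((Real.log (A.card : ℝ)) ^ ((1:ℝ)/3) *
          ((A.card : ℝ) ^ ((24:ℝ)/15) + (q : ℝ) ^ (-(1:ℝ)/12) * (A.card : ℝ) ^ ((21:ℝ)/12)) *
          (L.card : ℝ) ^ ((2:ℝ)/3) + (L.card : ℝ))) ∧
    (c' * (Real.log (A.card : ℝ)) ^ (-(2:ℝ)) *
      min ((A.card : ℝ) ^ ((2:ℝ) + 2/5)) ((q : ℝ) ^ ((1:ℝ)/2) * (A.card : ℝ) ^ ((2:ℝ) - 1/2)) ≤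
      (numLines (A ×ˢ A) : ℝ)) := by
  intro C K hC hK
  obtain ⟨C0, hC0⟩ : ∃ C0, C0 = 8 * ((2 + C ^ 2) * K ^ 33 + C + 2 * K ^ 28) + 8 := ⟨_, rfl⟩
  have hC1 : 1 ≤ C0 := by
    have : 0 ≤ (2 + C ^ 2) * K ^ 33 + C + 2 * K ^ 28 := by positivity
    linarith
  refine ⟨2 * C0, 1 / (32 * C0 ^ 2), by linarith, by positivity, ?_⟩
  intro F _ _ q _ hq A hA hAA hsub
  subst hq
  have ha2 : (2 : ℝ) ≤ A.card := by exact_mod_cast hA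
  have hK1 : 1 ≤ K := by
    have hne : A.Nonempty := Finset.card_pos.1 (by omega)
    have h : (A.card : ℝ) ≤ (A + A).card := by
      exact_mod_cast Finset.card_le_card_add_right hne
    by_contra hlt
    push Not at hlt
    nlinarith
  have hI := partI C K hC hK1 A hA hAA hsub
  rw [← hC0] at hI
  have hIII := partIII A hA
  have hq0 : (0 : ℝ) < Fintype.card F := by exact_mod_cast Fintype.card_pos
  have hlog : 0 < Real.log (A.card : ℝ) := Real.log_pos (by linarith)
  have hII := fun L hL => partII A L hL
  have hN0 : (0 : ℝ) ≤ numLines (A ×ˢ A) := Nat.cast_nonneg _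
  have hT0 : (0 : ℝ) ≤ collinearTriples A A := Nat.cast_nonneg _
  generalize (collinearTriples A A : ℝ) = T at *
  generalize (numLines (A ×ˢ A) : ℝ) = N at *
  generalize (A.card : ℝ) = a at *
  generalize (Fintype.card F : ℝ) = Q at *
  have ha0 : 0 < a := by linarith
  refine ⟨?_, ?_, ?_⟩
  · refine hI.trans ?_
    gcongr
    linarith
  · intro L hL
    obtain ⟨I2, h0, h1, h2⟩ := hII L hL
    refine h1.trans ?_
    have hl0 : (0 : ℝ) ≤ L.card := Nat.cast_nonneg _
    generalize (L.card : ℝ) = y at *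
    rw [mul_add]
    apply add_le_add
    swap
    · nlinarith
    set U := a ^ ((24:ℝ)/15) with hU
    set V := Q ^ (-(1:ℝ)/12) * a ^ ((21:ℝ)/12) with hV
    have hU0 : 0 ≤ U := by positivity
    have hV0 : 0 ≤ V := by positivity
    have hU3 : U ^ 3 = a ^ ((5:ℝ) - 1/5) := by
      rw [hU, ← Real.rpow_natCast, ← Real.rpow_mul ha0.le]; norm_num
    have hV3 : V ^ 3 = Q ^ (-(1:ℝ)/4) * a ^ ((5:ℝ) + 1/4) := by
      rw [hV, mul_pow, ← Real.rpow_natCast, ← Real.rpow_mul hq0.le, ← Real.rpow_natCast,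
        ← Real.rpow_mul ha0.le]; norm_num
    have hl3 : (Real.log a ^ ((1:ℝ)/3)) ^ 3 = Real.log a := by
      rw [← Real.rpow_natCast, ← Real.rpow_mul hlog.le]; norm_num
    have hy3 : (y ^ ((2:ℝ)/3)) ^ 3 = y ^ 2 := by
      rw [← Real.rpow_natCast, ← Real.rpow_mul hl0, ← Real.rpow_natCast]; norm_num
    rw [← hU3, ← hV3] at hI
    refine le_of_pow_le_pow_left₀ (n := 3) (by norm_num) (by positivity) ?_
    have hexp : (2 * C0 * (Real.log a ^ ((1:ℝ)/3) * (U + V) * y ^ ((2:ℝ)/3))) ^ 3 =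
        8 * C0 ^ 3 * Real.log a * (U + V) ^ 3 * y ^ 2 := by
      rw [← hy3]
      conv_rhs => rw [← hl3]
      ring
    rw [hexp]
    have hUV : U ^ 3 + V ^ 3 ≤ (U + V) ^ 3 := by
      have : 0 ≤ 3 * U * V * (U + V) := by positivity
      nlinarith
    have hC3 : C0 ≤ C0 ^ 3 := le_self_pow₀ hC1 (by norm_num)
    calc I2 ^ 3 ≤ y ^ 2 * (2 * T) := h2
      _ ≤ y ^ 2 * (2 * (C0 * Real.log a * (U ^ 3 + V ^ 3))) := by gcongr
      _ ≤ y ^ 2 * (2 * (C0 ^ 3 * Real.log a * (U + V) ^ 3)) := by gcongr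
      _ = 2 * (C0 ^ 3 * Real.log a * (U + V) ^ 3 * y ^ 2) := by ring
      _ ≤ 8 * (C0 ^ 3 * Real.log a * (U + V) ^ 3 * y ^ 2) := by
        gcongr
        norm_num
      _ = _ := by ring
  · set u := a ^ ((5:ℝ) - 1/5) with hu
    set v := Q ^ (-(1:ℝ)/4) * a ^ ((5:ℝ) + 1/4) with hv
    set m := min (a ^ ((2:ℝ) + 2/5)) (Q ^ ((1:ℝ)/2) * a ^ ((2:ℝ) - 1/2)) with hm
    have hm0 : 0 ≤ m := le_min (by positivity) (by positivity)
    have hu0 : 0 ≤ u := by positivity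
    have hv0 : 0 ≤ v := by positivity
    have e1 : u ^ 2 * a ^ ((2:ℝ) + 2/5) = a ^ 12 := by
      rw [hu, ← Real.rpow_natCast, ← Real.rpow_mul ha0.le, ← Real.rpow_add ha0,
        ← Real.rpow_natCast]
      norm_num
    have e2 : v ^ 2 * (Q ^ ((1:ℝ)/2) * a ^ ((2:ℝ) - 1/2)) = a ^ 12 := by
      have q1 : (Q ^ (-(1:ℝ)/4)) ^ 2 * Q ^ ((1:ℝ)/2) = 1 := by
        rw [← Real.rpow_natCast, ← Real.rpow_mul hq0.le, ← Real.rpow_add hq0]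
        norm_num
      have q2 : (a ^ ((5:ℝ) + 1/4)) ^ 2 * a ^ ((2:ℝ) - 1/2) = a ^ 12 := by
        rw [← Real.rpow_natCast, ← Real.rpow_mul ha0.le, ← Real.rpow_add ha0,
          ← Real.rpow_natCast]
        norm_num
      calc v ^ 2 * (Q ^ ((1:ℝ)/2) * a ^ ((2:ℝ) - 1/2)) =
          ((Q ^ (-(1:ℝ)/4)) ^ 2 * Q ^ ((1:ℝ)/2)) *
            ((a ^ ((5:ℝ) + 1/4)) ^ 2 * a ^ ((2:ℝ) - 1/2)) := by rw [hv]; ring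
        _ = _ := by rw [q1, q2, one_mul]
    have hmu : u ^ 2 * m ≤ a ^ 12 := by
      rw [← e1]; gcongr; exact min_le_left _ _
    have hmv : v ^ 2 * m ≤ a ^ 12 := by
      rw [← e2]; gcongr; exact min_le_right _ _
    have hX : m * (u + v) ^ 2 ≤ 4 * a ^ 12 := by
      nlinarith [mul_nonneg hm0 (sq_nonneg (u - v))]
    have hT2 : T ^ 2 ≤ C0 ^ 2 * Real.log a ^ 2 * (u + v) ^ 2 := by
      calc T ^ 2 ≤ (C0 * Real.log a * (u + v)) ^ 2 := by gcongr
        _ = _ := by ring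
    have hfin : a ^ 12 * m ≤ a ^ 12 * (32 * C0 ^ 2 * Real.log a ^ 2 * N) := by
      calc a ^ 12 * m = 8 * ((a ^ 4 / 2) ^ 3 * m) := by ring
        _ ≤ 8 * ((N * T ^ 2) * m) := by gcongr
        _ ≤ 8 * ((N * (C0 ^ 2 * Real.log a ^ 2 * (u + v) ^ 2)) * m) := by gcongr
        _ = 8 * N * C0 ^ 2 * Real.log a ^ 2 * (m * (u + v) ^ 2) := by ring
        _ ≤ 8 * N * C0 ^ 2 * Real.log a ^ 2 * (4 * a ^ 12) := by gcongr
        _ = _ := by ring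
    have hfin' := le_of_mul_le_mul_left hfin (by positivity)
    have hl : Real.log a ^ (-(2:ℝ)) = 1 / Real.log a ^ 2 := by
      rw [Real.rpow_neg hlog.le, one_div]
      congr 1
      exact_mod_cast Real.rpow_natCast (Real.log a) 2
    rw [hl]
    have : 1 / (32 * C0 ^ 2) * (1 / Real.log a ^ 2) * m = m / (32 * C0 ^ 2 * Real.log a ^ 2) := by
      field_simp
    rw [this, div_le_iff₀ (by positivity)]
    linarith

end STP
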